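/- arXiv:2106.07842 — 2 statements merged into one kernel-verified Lean document; each statement's English description precedes it below -/
import Mathlib

section
/- Along the fiber centerline, the regularized and classical slender-body fiber velocities differ by an explicit logarithmic term: there exist constants C > 0 and ε₀ > 0, depending only on c_Γ and κ_max, such that for all 0 < ε < ε₀, 0 < δ < ε₀, every f ∈ C¹(ℝ/ℤ; ℝ³), and every s ∈ ℝ/ℤ, |8π (u^δ(X(s)) − u^SB_C(X(s))) + 2 log(δ/ε) (I + e_s(s) e_s(s)ᵀ) f(s)| ≤ C (ε|log ε| + δ|log δ|) ‖f‖_{C¹}. In particular, if δ is proportional to ε, then δ = ε is necessary to avoid an O(1) discrepancy between the two fiber-velocity expressions as ε → 0. -/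
open MeasureTheory

noncomputable section

local notation "⟪" x ", " y "⟫" => @inner ℝ _ _ x y

abbrev V3 : Type := EuclideanSpace ℝ (Fin 3)

/-- The `C⁰` (sup) norm of a function `ℝ/ℤ → ℝ³`. -/
def C0norm (f : ℝ → V3) : ℝ := ⨆ s : ℝ, ‖f s‖

/-- The `C¹` norm of a function `ℝ/ℤ → ℝ³`. -/
def C1norm (f : ℝ → V3) : ℝ := C0norm f + C0norm (deriv f)

/-- The radial unit vector `e_ρ(s,θ) = cos θ e_{n1}(s) + sin θ e_{n2}(s)`. -/
def ePerp (en1 en2 : ℝ → V3) (s θ : ℝ) : V3 :=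
  Real.cos θ • en1 s + Real.sin θ • en2 s

/-- `R(s, s̄, θ) = X(s) + ε e_ρ(s,θ) − X(s − s̄)`. -/
def Rvec (X en1 en2 : ℝ → V3) (ε s sb θ : ℝ) : V3 :=
  X s + ε • ePerp en1 en2 s θ - X (s - sb)

/-- The slender-body geometry hypotheses: `X : ℝ/ℤ → ℝ³` is a `C²` closed curve
parameterized by arclength, non-self-intersecting with constant `cΓ`, with curvature
bounded by `κmax`, together with a `C¹` orthonormal frame `(X', en1, en2)`. -/
structure SlenderGeom (cΓ κmax : ℝ) (X en1 en2 : ℝ → V3) : Prop where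
  smooth : ContDiff ℝ 2 X
  periodicX : ∀ s, X (s + 1) = X s
  arclength : ∀ s, ‖deriv X s‖ = 1
  no_self_intersect : ∀ s t : ℝ, |s - t| ≤ 1 / 2 → cΓ * |s - t| ≤ ‖X s - X t‖
  curvature_max : ∀ s, ‖deriv (deriv X) s‖ ≤ κmax
  en1_smooth : ContDiff ℝ 1 en1
  en2_smooth : ContDiff ℝ 1 en2
  en1_periodic : ∀ s, en1 (s + 1) = en1 s
  en2_periodic : ∀ s, en2 (s + 1) = en2 s
  en1_unit : ∀ s, ‖en1 s‖ = 1
  en2_unit : ∀ s, ‖en2 s‖ = 1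
  es_en1 : ∀ s, ⟪deriv X s, en1 s⟫ = 0
  es_en2 : ∀ s, ⟪deriv X s, en2 s⟫ = 0
  en1_en2 : ∀ s, ⟪en1 s, en2 s⟫ = 0

/-- The singular Stokeslet `S(y) v = v/|y| + (y·v) y/|y|³`. -/
def stokeslet (y v : V3) : V3 := ‖y‖⁻¹ • v + (‖y‖ ^ 3)⁻¹ • ⟪y, v⟫ • y

/-- The singular doublet `D(y) v = v/|y|³ − 3 (y·v) y/|y|⁵`. -/
def doubletK (y v : V3) : V3 := (‖y‖ ^ 3)⁻¹ • v - (3 * (‖y‖ ^ 5)⁻¹) • ⟪y, v⟫ • y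

/-- The regularized Stokeslet `S_δ(y) v`. -/
def stokesletReg (δ : ℝ) (y v : V3) : V3 :=
  ((‖y‖ ^ 2 + δ ^ 2) ^ ((1 : ℝ) / 2))⁻¹ • v
    + ((‖y‖ ^ 2 + δ ^ 2) ^ ((3 : ℝ) / 2))⁻¹ • (⟪y, v⟫ • y + δ ^ 2 • v)

/-- The regularized doublet `D_δ(y) v`. -/
def doubletReg (δ : ℝ) (y v : V3) : V3 :=
  ((‖y‖ ^ 2 + δ ^ 2) ^ ((3 : ℝ) / 2))⁻¹ • v
    - (3 * ((‖y‖ ^ 2 + δ ^ 2) ^ ((5 : ℝ) / 2))⁻¹) • (⟪y, v⟫ • y + δ ^ 2 • v)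

/-- The classical slender-body velocity `u^SB(x)` with doublet coefficient `ε²/2`. -/
def uSB (X f : ℝ → V3) (ε : ℝ) (x : V3) : V3 :=
  (8 * Real.pi)⁻¹ • ∫ t in (0:ℝ)..1,
    (stokeslet (x - X t) (f t) + (ε ^ 2 / 2) • doubletK (x - X t) (f t))

/-- The regularized slender-body velocity with doublet coefficient `β`. -/
def uReg (X f : ℝ → V3) (β δ : ℝ) (x : V3) : V3 :=
  (8 * Real.pi)⁻¹ • ∫ t in (0:ℝ)..1,
    (stokesletReg δ (x - X t) (f t) + β • doubletReg δ (x - X t) (f t))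

/-- The Keller–Rubinow classical centerline velocity `u^SB_C(X(s))`. -/
def uSBC (X f : ℝ → V3) (ε s : ℝ) : V3 :=
  (8 * Real.pi)⁻¹ •
    ((f s - (3 : ℝ) • ⟪deriv X s, f s⟫ • deriv X s
        - (2 * Real.log (Real.pi * ε / 4)) • (f s + ⟪deriv X s, f s⟫ • deriv X s))
      + ∫ t in (0:ℝ)..1,
          ((‖X s - X t‖⁻¹ • f t
              + (‖X s - X t‖ ^ 3)⁻¹ • ⟪X s - X t, f t⟫ • (X s - X t))
            - |Real.sin (Real.pi * (s - t)) / Real.pi|⁻¹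
                • (f s + ⟪deriv X s, f s⟫ • deriv X s)))

/-- The regularized pressure `p^δ(x)`. -/
def pReg (X f : ℝ → V3) (δ : ℝ) (x : V3) : ℝ :=
  (4 * Real.pi)⁻¹ * ∫ t in (0:ℝ)..1,
    (⟪x - X t, f t⟫ * ((‖x - X t‖ ^ 2 + δ ^ 2) ^ ((3 : ℝ) / 2))⁻¹
      + 3 * δ ^ 2 * ⟪x - X t, f t⟫ * (2 * (‖x - X t‖ ^ 2 + δ ^ 2) ^ ((5 : ℝ) / 2))⁻¹)

/-- The symmetric strain tensor `E(u) = (∇u + (∇u)ᵀ)/2` applied to the vector `n`. -/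
def strainApply (u : V3 → V3) (x n : V3) : V3 :=
  (2 : ℝ)⁻¹ • (fderiv ℝ u x n + gradient (fun y => ⟪u y, n⟫) x)

/-- The surface Jacobian `J_ε(s,θ) = ε(1 − ε(κ₁ cos θ + κ₂ sin θ))`. -/
def Jfac (X en1 en2 : ℝ → V3) (ε s θ : ℝ) : ℝ :=
  ε * (1 - ε * (⟪deriv (deriv X) s, en1 s⟫ * Real.cos θ
      + ⟪deriv (deriv X) s, en2 s⟫ * Real.sin θ))

/-- The regularized surface force density
`f^δ(s) = ∫_0^{2π} (2 E(u^δ) n − p^δ n) J_ε dθ`, with `n = −e_ρ`. -/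
def fReg (X en1 en2 f : ℝ → V3) (ε δ s : ℝ) : V3 :=
  ∫ θ in (0:ℝ)..(2 * Real.pi),
    Jfac X en1 en2 ε s θ •
      ((2 : ℝ) • strainApply (uReg X f ((ε ^ 2 + δ ^ 2) / 2) δ)
          (X s + ε • ePerp en1 en2 s θ) (-ePerp en1 en2 s θ)
        - pReg X f δ (X s + ε • ePerp en1 en2 s θ) • (-ePerp en1 en2 s θ))

/-- The vector field `d_n^δ[f](x)`. -/
def dReg (X f : ℝ → V3) (δ : ℝ) (n : ℕ) (x : V3) : V3 :=
  (8 * Real.pi)⁻¹ • ∫ t in (0:ℝ)..1,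
    (δ ^ 2 * ((‖x - X t‖ ^ 2 + δ ^ 2) ^ ((n : ℝ) / 2))⁻¹) • f t

/-- The scalar field `d_5^δ[f·R](x)`. -/
def dRegP (X f : ℝ → V3) (δ : ℝ) (x : V3) : ℝ :=
  (8 * Real.pi)⁻¹ * ∫ t in (0:ℝ)..1,
    δ ^ 2 * ⟪x - X t, f t⟫ * ((‖x - X t‖ ^ 2 + δ ^ 2) ^ ((5 : ℝ) / 2))⁻¹

/-- The extra force contribution
`F^δ(s) = ∫_0^{2π} (2E(d₃^δ[f])n − 3(ε²+δ²)E(d₅^δ[f])n − 3 d₅^δ[f·R] n) J_ε dθ`. -/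
def Fextra (X en1 en2 f : ℝ → V3) (ε δ s : ℝ) : V3 :=
  ∫ θ in (0:ℝ)..(2 * Real.pi),
    Jfac X en1 en2 ε s θ •
      ((2 : ℝ) • strainApply (dReg X f δ 3) (X s + ε • ePerp en1 en2 s θ)
          (-ePerp en1 en2 s θ)
        - (3 * (ε ^ 2 + δ ^ 2)) • strainApply (dReg X f δ 5)
            (X s + ε • ePerp en1 en2 s θ) (-ePerp en1 en2 s θ)
        - (3 * dRegP X f δ (X s + ε • ePerp en1 en2 s θ)) • (-ePerp en1 en2 s θ))

/-- `√(p² + δ²)`. -/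
def regRadius (δ p : ℝ) : ℝ := √(p ^ 2 + δ ^ 2)

/-- The identity coefficient of the doublet-corrected regularized Stokeslet at distance `p`. -/
def regCoeffId (δ p : ℝ) : ℝ :=
  (regRadius δ p)⁻¹ + 3 / 2 * δ ^ 2 * (regRadius δ p ^ 3)⁻¹
    - 3 / 2 * δ ^ 4 * (regRadius δ p ^ 5)⁻¹

/-- The dyadic coefficient of the doublet-corrected regularized Stokeslet at distance `p`. -/
def regCoeffDyad (δ p : ℝ) : ℝ :=
  (regRadius δ p ^ 3)⁻¹ - 3 / 2 * δ ^ 2 * (regRadius δ p ^ 5)⁻¹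

/-- `regCoeffId` minus the identity coefficient of the singular Stokeslet. -/
def defectId (δ p : ℝ) : ℝ := regCoeffId δ p - p⁻¹

/-- `regCoeffDyad` minus the dyadic coefficient of the singular Stokeslet. -/
def defectDyad (δ p : ℝ) : ℝ := regCoeffDyad δ p - (p ^ 3)⁻¹

lemma regRadius_sq (δ p : ℝ) : regRadius δ p ^ 2 = p ^ 2 + δ ^ 2 :=
  Real.sq_sqrt (by positivity)

lemma regRadius_pos {δ : ℝ} (hδ : 0 < δ) (p : ℝ) : 0 < regRadius δ p :=
  Real.sqrt_pos.2 (by positivity)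

lemma continuous_regRadius (δ : ℝ) : Continuous (regRadius δ) := by
  unfold regRadius; fun_prop

lemma hasDerivAt_regRadius {δ : ℝ} (hδ : 0 < δ) (p : ℝ) :
    HasDerivAt (regRadius δ) (p / regRadius δ p) p := by
  refine (((hasDerivAt_pow 2 p).add_const (δ ^ 2)).sqrt (by positivity)).congr_deriv ?_
  rw [← regRadius]
  have := (regRadius_pos hδ p).ne'
  field_simp
  norm_num

lemma hasDerivAt_div_regRadius {δ : ℝ} (hδ : 0 < δ) (p : ℝ) :
    HasDerivAt (fun z => z / regRadius δ z) (δ ^ 2 / regRadius δ p ^ 3) p := by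
  have hρ := (regRadius_pos hδ p).ne'
  refine ((hasDerivAt_id' p).div (hasDerivAt_regRadius hδ p) hρ).congr_deriv ?_
  have := regRadius_sq δ p
  field_simp
  linarith

lemma div_regRadius_mem {δ p : ℝ} (hδ : 0 < δ) (hp : 0 < p) :
    0 ≤ p / regRadius δ p ∧ p / regRadius δ p ≤ 1 := by
  have hρ := regRadius_pos hδ p
  refine ⟨by positivity, (div_le_one hρ).2 (Real.le_sqrt_of_sq_le (by nlinarith))⟩

lemma one_sub_div_regRadius_sq {δ : ℝ} (hδ : 0 < δ) (p : ℝ) :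
    1 - (p / regRadius δ p) ^ 2 = δ ^ 2 / (p ^ 2 + δ ^ 2) := by
  have hρ := (regRadius_pos hδ p).ne'
  have := regRadius_sq δ p
  rw [← this]
  field_simp
  linarith

lemma defectId_eq {δ p : ℝ} (hδ : 0 < δ) (hp : 0 < p) :
    defectId δ p = (-1 + p / regRadius δ p + 3 / 2 * (p / regRadius δ p) ^ 3
      - 3 / 2 * (p / regRadius δ p) ^ 5) / p := by
  have hρ := (regRadius_pos hδ p).ne'
  have h : δ ^ 2 = regRadius δ p ^ 2 - p ^ 2 := by rw [regRadius_sq]; ring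
  have h4 : δ ^ 4 = (regRadius δ p ^ 2 - p ^ 2) ^ 2 := by rw [← h]; ring
  unfold defectId regCoeffId
  rw [h4, h]
  field_simp
  ring

lemma defectDyad_eq {δ p : ℝ} (hδ : 0 < δ) (hp : 0 < p) :
    defectDyad δ p = (-1 - 1 / 2 * (p / regRadius δ p) ^ 3
      + 3 / 2 * (p / regRadius δ p) ^ 5) / p ^ 3 := by
  have hρ := (regRadius_pos hδ p).ne'
  have h : δ ^ 2 = regRadius δ p ^ 2 - p ^ 2 := by rw [regRadius_sq]; ring
  unfold defectDyad regCoeffDyad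
  rw [h]
  field_simp
  ring

lemma abs_polyId_le {x : ℝ} (h0 : 0 ≤ x) (h1 : x ≤ 1) :
    |-1 + x + 3 / 2 * x ^ 3 - 3 / 2 * x ^ 5| ≤ 5 * (1 - x ^ 2) := by
  have h3 : x ^ 3 ≤ 1 := pow_le_one₀ h0 h1
  have h3' : 0 ≤ x ^ 3 := by positivity
  have h2 : 0 ≤ 1 - x ^ 2 := by nlinarith
  rw [show -1 + x + 3 / 2 * x ^ 3 - 3 / 2 * x ^ 5
    = -(1 - x) + 3 / 2 * (x ^ 3 * (1 - x ^ 2)) by ring]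
  have : x ^ 3 * (1 - x ^ 2) ≤ 1 - x ^ 2 := by nlinarith
  have : 0 ≤ x ^ 3 * (1 - x ^ 2) := by positivity
  rw [abs_le]; constructor <;> nlinarith

lemma abs_polyDyad_le {x : ℝ} (h0 : 0 ≤ x) (h1 : x ≤ 1) :
    |-1 - 1 / 2 * x ^ 3 + 3 / 2 * x ^ 5| ≤ 5 * (1 - x ^ 2) := by
  have h3 : x ^ 3 ≤ 1 := pow_le_one₀ h0 h1
  have h3' : 0 ≤ x ^ 3 := by positivity
  have h2 : 0 ≤ 1 - x ^ 2 := by nlinarith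
  rw [show -1 - 1 / 2 * x ^ 3 + 3 / 2 * x ^ 5
    = -((1 - x) * (1 + x + x ^ 2)) - 3 / 2 * (x ^ 3 * (1 - x ^ 2)) by ring]
  have : x ^ 3 * (1 - x ^ 2) ≤ 1 - x ^ 2 := by nlinarith
  have : 0 ≤ x ^ 3 * (1 - x ^ 2) := by positivity
  have : (1 - x) * (1 + x + x ^ 2) ≤ 3 * (1 - x ^ 2) := by
    nlinarith [mul_nonneg h0 (sub_nonneg.2 h1), mul_nonneg (mul_nonneg h0 h0) (sub_nonneg.2 h1)]
  have : 0 ≤ (1 - x) * (1 + x + x ^ 2) := mul_nonneg (by linarith) (by positivity)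
  rw [abs_le]; constructor <;> nlinarith

lemma abs_defectId_le {δ p : ℝ} (hδ : 0 < δ) (hp : 0 < p) :
    |defectId δ p| ≤ 5 * (δ ^ 2 / (p ^ 2 + δ ^ 2)) / p := by
  obtain ⟨h0, h1⟩ := div_regRadius_mem hδ hp
  rw [defectId_eq hδ hp, abs_div, abs_of_pos hp, ← one_sub_div_regRadius_sq hδ]
  gcongr
  exact abs_polyId_le h0 h1

lemma abs_defectDyad_le {δ p : ℝ} (hδ : 0 < δ) (hp : 0 < p) :
    |defectDyad δ p| ≤ 5 * (δ ^ 2 / (p ^ 2 + δ ^ 2)) / p ^ 3 := by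
  obtain ⟨h0, h1⟩ := div_regRadius_mem hδ hp
  rw [defectDyad_eq hδ hp, abs_div, abs_of_pos (pow_pos hp 3), ← one_sub_div_regRadius_sq hδ]
  gcongr
  exact abs_polyDyad_le h0 h1

lemma hasDerivAt_defectId {δ p x : ℝ} (hδ : 0 < δ) (hp : 0 < p) (hx : x = p / regRadius δ p) :
    HasDerivAt (defectId δ) (((1 + 9 / 2 * x ^ 2 - 15 / 2 * x ^ 4) * x * (1 - x ^ 2)
      - (-1 + x + 3 / 2 * x ^ 3 - 3 / 2 * x ^ 5)) / p ^ 2) p := by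
  have hxd := hasDerivAt_div_regRadius hδ p
  have hev : defectId δ =ᶠ[nhds p] fun z => (-1 + z / regRadius δ z
      + 3 / 2 * (z / regRadius δ z) ^ 3 - 3 / 2 * (z / regRadius δ z) ^ 5) / z := by
    filter_upwards [lt_mem_nhds hp] with z hz using defectId_eq hδ hz
  refine HasDerivAt.congr_of_eventuallyEq (HasDerivAt.congr_deriv
    ((((hxd.const_add (-1)).fun_add ((hxd.fun_pow 3).const_mul (3 / 2))).fun_sub
    ((hxd.fun_pow 5).const_mul (3 / 2))).fun_div (hasDerivAt_id' p) hp.ne') ?_) hev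
  have hρ := regRadius_pos hδ p
  rw [show δ ^ 2 / regRadius δ p ^ 3 = (1 - (p / regRadius δ p) ^ 2) * (p / regRadius δ p) / p by
    rw [one_sub_div_regRadius_sq hδ, ← regRadius_sq]; field_simp, ← hx]
  field_simp
  push_cast
  ring

lemma hasDerivAt_defectDyad {δ p x : ℝ} (hδ : 0 < δ) (hp : 0 < p) (hx : x = p / regRadius δ p) :
    HasDerivAt (defectDyad δ) (((-3 / 2 * x ^ 2 + 15 / 2 * x ^ 4) * x * (1 - x ^ 2)
      - 3 * (-1 - 1 / 2 * x ^ 3 + 3 / 2 * x ^ 5)) / p ^ 4) p := by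
  have hxd := hasDerivAt_div_regRadius hδ p
  have hev : defectDyad δ =ᶠ[nhds p] fun z => (-1 - 1 / 2 * (z / regRadius δ z) ^ 3
      + 3 / 2 * (z / regRadius δ z) ^ 5) / z ^ 3 := by
    filter_upwards [lt_mem_nhds hp] with z hz using defectDyad_eq hδ hz
  refine HasDerivAt.congr_of_eventuallyEq (HasDerivAt.congr_deriv
    ((((hxd.fun_pow 3).const_mul (1 / 2)).const_sub (-1)).fun_add
    ((hxd.fun_pow 5).const_mul (3 / 2)) |>.fun_div (hasDerivAt_pow 3 p) (pow_pos hp 3).ne') ?_) hev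
  have hρ := regRadius_pos hδ p
  rw [show δ ^ 2 / regRadius δ p ^ 3 = (1 - (p / regRadius δ p) ^ 2) * (p / regRadius δ p) / p by
    rw [one_sub_div_regRadius_sq hδ, ← regRadius_sq]; field_simp, ← hx]
  field_simp
  push_cast
  ring

lemma exists_hasDerivAt_defectId {δ p : ℝ} (hδ : 0 < δ) (hp : 0 < p) :
    ∃ d, HasDerivAt (defectId δ) d p ∧ |d| ≤ 20 * (δ ^ 2 / (p ^ 2 + δ ^ 2)) / p ^ 2 := by
  obtain ⟨h0, h1⟩ := div_regRadius_mem hδ hp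
  refine ⟨_, hasDerivAt_defectId hδ hp rfl, ?_⟩
  rw [← one_sub_div_regRadius_sq hδ p]
  set x := p / regRadius δ p with hxdef
  have hP := abs_polyId_le h0 h1
  have h2 : x ^ 2 ≤ 1 := pow_le_one₀ h0 h1
  have hP' : |(1 + 9 / 2 * x ^ 2 - 15 / 2 * x ^ 4) * x| ≤ 15 := by
    have h3 : x ^ 3 ≤ 1 := pow_le_one₀ h0 h1
    have h5 : x ^ 5 ≤ 1 := pow_le_one₀ h0 h1
    have h3' : 0 ≤ x ^ 3 := by positivity
    have h5' : 0 ≤ x ^ 5 := by positivity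
    rw [abs_le]; constructor <;> nlinarith
  rw [abs_div, abs_of_pos (pow_pos hp 2)]
  gcongr
  refine (abs_sub _ _).trans ?_
  rw [abs_mul _ (1 - x ^ 2), abs_of_nonneg (by linarith : 0 ≤ 1 - x ^ 2)]
  nlinarith

lemma exists_hasDerivAt_defectDyad {δ p : ℝ} (hδ : 0 < δ) (hp : 0 < p) :
    ∃ d, HasDerivAt (defectDyad δ) d p ∧ |d| ≤ 24 * (δ ^ 2 / (p ^ 2 + δ ^ 2)) / p ^ 4 := by
  obtain ⟨h0, h1⟩ := div_regRadius_mem hδ hp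
  refine ⟨_, hasDerivAt_defectDyad hδ hp rfl, ?_⟩
  rw [← one_sub_div_regRadius_sq hδ p]
  set x := p / regRadius δ p with hxdef
  have hQ := abs_polyDyad_le h0 h1
  have h2 : x ^ 2 ≤ 1 := pow_le_one₀ h0 h1
  have hQ' : |(-3 / 2 * x ^ 2 + 15 / 2 * x ^ 4) * x| ≤ 9 := by
    have h3 : x ^ 3 ≤ 1 := pow_le_one₀ h0 h1
    have h5 : x ^ 5 ≤ 1 := pow_le_one₀ h0 h1
    have h3' : 0 ≤ x ^ 3 := by positivity
    have h5' : 0 ≤ x ^ 5 := by positivity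
    rw [abs_le]; constructor <;> nlinarith
  rw [abs_div, abs_of_pos (pow_pos hp 4)]
  gcongr
  refine (abs_sub _ _).trans ?_
  rw [abs_mul _ (1 - x ^ 2), abs_mul 3, abs_of_nonneg (by linarith : 0 ≤ 1 - x ^ 2),
    abs_of_pos (by norm_num : (0 : ℝ) < 3)]
  nlinarith

lemma lorentz_le {c δ q z : ℝ} (hc : 0 < c) (hc1 : c ≤ 1) (hδ : 0 < δ) (hq : 0 < q)
    (hz : c * q ≤ z) : δ ^ 2 / (z ^ 2 + δ ^ 2) ≤ δ ^ 2 / (q ^ 2 + δ ^ 2) / c ^ 2 := by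
  have h1 : (c * q) ^ 2 ≤ z ^ 2 := by gcongr
  have h2 : c ^ 2 ≤ 1 := pow_le_one₀ hc.le hc1
  rw [div_div]
  gcongr
  nlinarith [sq_nonneg δ]

lemma abs_sub_le_of_deriv_le {g : ℝ → ℝ} {m p q B : ℝ} (hp : m ≤ p) (hq : m ≤ q)
    (hg : ∀ z, m ≤ z → ∃ d, HasDerivAt g d z ∧ |d| ≤ B) : |g p - g q| ≤ B * |p - q| := by
  rw [← Real.norm_eq_abs, ← Real.norm_eq_abs]
  refine (convex_Ici m).norm_image_sub_le_of_norm_deriv_le (𝕜 := ℝ)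
    (fun z hz => ?_) (fun z hz => ?_) hq hp
  · obtain ⟨d, hd, -⟩ := hg z hz
    exact hd.differentiableAt
  · obtain ⟨d, hd, hB⟩ := hg z hz
    rwa [hd.deriv]

lemma abs_defectId_sub_le {c δ p q : ℝ} (hc : 0 < c) (hc1 : c ≤ 1) (hδ : 0 < δ) (hq : 0 < q)
    (hp : c * q ≤ p) : |defectId δ p - defectId δ q|
      ≤ 20 * (δ ^ 2 / (q ^ 2 + δ ^ 2) / c ^ 2) / (c * q) ^ 2 * |p - q| := by
  refine abs_sub_le_of_deriv_le hp (by nlinarith) fun z hz => ?_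
  obtain ⟨d, hd, hB⟩ := exists_hasDerivAt_defectId hδ ((mul_pos hc hq).trans_le hz)
  refine ⟨d, hd, hB.trans ?_⟩
  have := lorentz_le hc hc1 hδ hq hz
  gcongr

lemma abs_defectDyad_sub_le {c δ p q : ℝ} (hc : 0 < c) (hc1 : c ≤ 1) (hδ : 0 < δ) (hq : 0 < q)
    (hp : c * q ≤ p) : |defectDyad δ p - defectDyad δ q|
      ≤ 24 * (δ ^ 2 / (q ^ 2 + δ ^ 2) / c ^ 2) / (c * q) ^ 4 * |p - q| := by
  refine abs_sub_le_of_deriv_le hp (by nlinarith) fun z hz => ?_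
  obtain ⟨d, hd, hB⟩ := exists_hasDerivAt_defectDyad hδ ((mul_pos hc hq).trans_le hz)
  refine ⟨d, hd, hB.trans ?_⟩
  have := lorentz_le hc hc1 hδ hq hz
  gcongr

lemma norm_kernel_sub_le (a a' b b' : ℝ) (r y f f' : V3) :
    ‖(a' • f' + (b' * ⟪r, f'⟫) • r) - (a • f + (b * ⟪y, f⟫) • y)‖
      ≤ |a'| * ‖f' - f‖ + |a' - a| * ‖f‖
        + |b'| * (‖r‖ ^ 2 * ‖f' - f‖ + (‖r‖ + ‖y‖) * ‖r - y‖ * ‖f‖)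
        + |b' - b| * (‖y‖ ^ 2 * ‖f‖) := by
  have hsplit : (a' • f' + (b' * ⟪r, f'⟫) • r) - (a • f + (b * ⟪y, f⟫) • y)
      = a' • (f' - f) + (a' - a) • f
        + b' • (⟪r, f' - f⟫ • r + (⟪r - y, f⟫ • r + ⟪y, f⟫ • (r - y)))
        + (b' - b) • (⟪y, f⟫ • y) := by
    simp only [inner_sub_left, inner_sub_right]
    module
  have hinner : ∀ u v w : V3, ‖⟪u, v⟫ • w‖ ≤ ‖u‖ * ‖v‖ * ‖w‖ := fun u v w => by
    rw [norm_smul]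
    gcongr
    exact norm_inner_le_norm u v
  have h1 := hinner r (f' - f) r
  have h2 := hinner (r - y) f r
  have h3 := hinner y f (r - y)
  have h4 := hinner y f y
  rw [hsplit]
  refine norm_add₄_le.trans ?_
  simp only [norm_smul a', norm_smul (a' - a), norm_smul b', norm_smul (b' - b), Real.norm_eq_abs]
  gcongr
  · refine (norm_add_le _ _).trans (add_le_add (h1.trans_eq (by ring)) ?_)
    refine (norm_add_le _ _).trans ((add_le_add h2 h3).trans_eq (by ring))
  · exact h4.trans_eq (by ring)

/-- The doublet-corrected regularized Stokeslet minus the singular Stokeslet. -/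
def kernelDefect (δ : ℝ) (y v : V3) : V3 :=
  defectId δ ‖y‖ • v + (defectDyad δ ‖y‖ * ⟪y, v⟫) • y

/-- The constant of the pointwise comparison of `kernelDefect` on the curve and on its tangent. -/
def defectConst (c κ : ℝ) : ℝ :=
  5 / c ^ 3 + 20 * κ / c ^ 4 + 5 * (1 + 2 * κ) / c ^ 5 + 24 * κ / c ^ 6

lemma norm_kernelDefect_sub_le {c κ δ M σ : ℝ} (hc : 0 < c) (hc1 : c ≤ 1) (hκ : 0 ≤ κ)
    (hδ : 0 < δ) (hσ : σ ≠ 0) {r e f f' : V3} (he : ‖e‖ = 1)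
    (hre : ‖r - σ • e‖ ≤ κ * σ ^ 2) (hr : c * |σ| ≤ ‖r‖) (hr' : ‖r‖ ≤ |σ|)
    (hf : ‖f‖ ≤ M) (hff : ‖f' - f‖ ≤ M * |σ|) :
    ‖kernelDefect δ r f' - kernelDefect δ (σ • e) f‖
      ≤ defectConst c κ * M * (δ ^ 2 / (σ ^ 2 + δ ^ 2)) := by
  have hy : ‖σ • e‖ = |σ| := by rw [norm_smul, he, mul_one, Real.norm_eq_abs]
  rw [← sq_abs σ] at hre ⊢
  have hq : 0 < |σ| := abs_pos.2 hσ
  have hM : 0 ≤ M := (norm_nonneg f).trans hf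
  have hpq : |(‖r‖ - |σ|)| ≤ κ * |σ| ^ 2 := by
    rw [← hy]
    exact (abs_norm_sub_norm_le _ _).trans (by rwa [hy])
  have hr0 : 0 < ‖r‖ := (mul_pos hc hq).trans_le hr
  refine (norm_kernel_sub_le _ _ _ _ _ _ _ _).trans ?_
  rw [hy]
  set q := |σ|
  set W := δ ^ 2 / (q ^ 2 + δ ^ 2) with hW
  have hW0 : 0 ≤ W := by positivity
  have hl := lorentz_le hc hc1 hδ hq hr
  rw [← hW] at hl
  have h1 : |defectId δ ‖r‖| ≤ 5 * (W / c ^ 2) / (c * q) := by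
    refine (abs_defectId_le hδ hr0).trans ?_
    gcongr
  have h2 : |defectId δ ‖r‖ - defectId δ q| ≤ 20 * (W / c ^ 2) / (c * q) ^ 2 * (κ * q ^ 2) := by
    refine (abs_defectId_sub_le hc hc1 hδ hq hr).trans ?_
    gcongr
  have h3 : |defectDyad δ ‖r‖| ≤ 5 * (W / c ^ 2) / (c * q) ^ 3 := by
    refine (abs_defectDyad_le hδ hr0).trans ?_
    gcongr
  have h4 : |defectDyad δ ‖r‖ - defectDyad δ q|
      ≤ 24 * (W / c ^ 2) / (c * q) ^ 4 * (κ * q ^ 2) := by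
    refine (abs_defectDyad_sub_le hc hc1 hδ hq hr).trans ?_
    gcongr
  calc _ ≤ 5 * (W / c ^ 2) / (c * q) * (M * q)
        + 20 * (W / c ^ 2) / (c * q) ^ 2 * (κ * q ^ 2) * M
        + 5 * (W / c ^ 2) / (c * q) ^ 3 * (q ^ 2 * (M * q) + (q + q) * (κ * q ^ 2) * M)
        + 24 * (W / c ^ 2) / (c * q) ^ 4 * (κ * q ^ 2) * (q ^ 2 * M) := by gcongr
    _ = _ := by
        unfold defectConst
        field_simp
        ring

lemma regKernel_eq {δ : ℝ} (y v : V3) :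
    stokesletReg δ y v + (δ ^ 2 / 2) • doubletReg δ y v
      = regCoeffId δ ‖y‖ • v + (regCoeffDyad δ ‖y‖ * ⟪y, v⟫) • y := by
  have hpos : 0 ≤ ‖y‖ ^ 2 + δ ^ 2 := by positivity
  have h1 : (‖y‖ ^ 2 + δ ^ 2) ^ ((1 : ℝ) / 2) = regRadius δ ‖y‖ := by
    rw [regRadius, Real.sqrt_eq_rpow]
  have h3 : (‖y‖ ^ 2 + δ ^ 2) ^ ((3 : ℝ) / 2) = regRadius δ ‖y‖ ^ 3 := by
    rw [← h1, ← Real.rpow_mul_natCast hpos]; norm_num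
  have h5 : (‖y‖ ^ 2 + δ ^ 2) ^ ((5 : ℝ) / 2) = regRadius δ ‖y‖ ^ 5 := by
    rw [← h1, ← Real.rpow_mul_natCast hpos]; norm_num
  unfold stokesletReg doubletReg regCoeffId regCoeffDyad
  rw [h1, h3, h5]
  module

lemma regRadius_abs (δ p : ℝ) : regRadius δ |p| = regRadius δ p := by
  rw [regRadius, sq_abs, regRadius]

lemma regRadius_neg (δ p : ℝ) : regRadius δ (-p) = regRadius δ p := by
  rw [regRadius, neg_sq, regRadius]

lemma continuous_regCoeffId {δ : ℝ} (hδ : 0 < δ) : Continuous (regCoeffId δ) := by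
  have := continuous_regRadius δ
  have h0 : ∀ p, regRadius δ p ≠ 0 := fun p => (regRadius_pos hδ p).ne'
  unfold regCoeffId
  fun_prop (disch := simp [h0])

lemma continuous_regCoeffDyad {δ : ℝ} (hδ : 0 < δ) : Continuous (regCoeffDyad δ) := by
  have := continuous_regRadius δ
  have h0 : ∀ p, regRadius δ p ≠ 0 := fun p => (regRadius_pos hδ p).ne'
  unfold regCoeffDyad
  fun_prop (disch := simp [h0])

lemma hasDerivAt_arsinh_div {δ : ℝ} (hδ : 0 < δ) (p : ℝ) :
    HasDerivAt (fun z => Real.arsinh (z / δ)) (regRadius δ p)⁻¹ p := by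
  refine ((hasDerivAt_id' p).div_const δ).arsinh.congr_deriv ?_
  have : regRadius δ p = √(1 + (p / δ) ^ 2) * δ := by
    rw [regRadius, show p ^ 2 + δ ^ 2 = (1 + (p / δ) ^ 2) * δ ^ 2 by field_simp; ring,
      Real.sqrt_mul (by positivity), Real.sqrt_sq hδ.le]
  rw [this, mul_inv, smul_eq_mul, one_div]

lemma integral_regCoeffId {δ : ℝ} (hδ : 0 < δ) :
    ∫ σ in (-(1 / 2) : ℝ)..(1 / 2), regCoeffId δ σ
      = 2 * Real.arsinh (1 / 2 / δ) + (1 / 2 / regRadius δ (1 / 2)) ^ 3 := by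
  rw [intervalIntegral.integral_eq_sub_of_hasDerivAt
    (f := fun z => Real.arsinh (z / δ) + 1 / 2 * (z / regRadius δ z) ^ 3)]
  · simp only [regRadius_neg, neg_div, Real.arsinh_neg]
    ring
  · intro p _
    refine ((hasDerivAt_arsinh_div hδ p).fun_add
      (((hasDerivAt_div_regRadius hδ p).fun_pow 3).const_mul (1 / 2))).congr_deriv ?_
    have hρ := (regRadius_pos hδ p).ne'
    have h : p ^ 2 = regRadius δ p ^ 2 - δ ^ 2 := by rw [regRadius_sq]; ring
    unfold regCoeffId
    rw [div_pow, h]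
    field_simp
    push_cast
    ring
  · exact (continuous_regCoeffId hδ).intervalIntegrable _ _

lemma integral_regCoeffDyad {δ : ℝ} (hδ : 0 < δ) :
    ∫ σ in (-(1 / 2) : ℝ)..(1 / 2), regCoeffDyad δ σ * σ ^ 2
      = 2 * Real.arsinh (1 / 2 / δ) - 2 * (1 / 2 / regRadius δ (1 / 2))
        - (1 / 2 / regRadius δ (1 / 2)) ^ 3 := by
  rw [intervalIntegral.integral_eq_sub_of_hasDerivAt
    (f := fun z => Real.arsinh (z / δ) - z / regRadius δ z - 1 / 2 * (z / regRadius δ z) ^ 3)]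
  · simp only [regRadius_neg, neg_div, Real.arsinh_neg]
    ring
  · intro p _
    refine (((hasDerivAt_arsinh_div hδ p).fun_sub (hasDerivAt_div_regRadius hδ p)).fun_sub
      (((hasDerivAt_div_regRadius hδ p).fun_pow 3).const_mul (1 / 2))).congr_deriv ?_
    have hρ := (regRadius_pos hδ p).ne'
    have h : p ^ 2 = regRadius δ p ^ 2 - δ ^ 2 := by rw [regRadius_sq]; ring
    unfold regCoeffDyad
    rw [div_pow, h]
    field_simp
    push_cast
    ring
  · exact ((continuous_regCoeffDyad hδ).mul (by fun_prop)).intervalIntegrable _ _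

lemma hasDerivAt_log_sinc_sub_log_cos {x : ℝ} (h0 : 0 < x) (h1 : x < 1) :
    HasDerivAt (fun z => Real.log (Real.sinc (Real.pi / 2 * z))
        - Real.log (Real.cos (Real.pi / 2 * z)))
      ((Real.sin (Real.pi * x) / Real.pi)⁻¹ - x⁻¹) x := by
  have hπ := Real.pi_pos
  have hs : 0 < Real.sin (Real.pi / 2 * x) :=
    Real.sin_pos_of_pos_of_lt_pi (by positivity) (by nlinarith)
  have hc : 0 < Real.cos (Real.pi / 2 * x) :=
    Real.cos_pos_of_mem_Ioo ⟨by nlinarith, by nlinarith⟩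
  have hlin : HasDerivAt (fun z => Real.pi / 2 * z) (Real.pi / 2) x := by
    simpa using (hasDerivAt_id' x).const_mul (Real.pi / 2)
  have hsinc : HasDerivAt (fun z => Real.sinc (Real.pi / 2 * z))
      ((Real.cos (Real.pi / 2 * x) * (Real.pi / 2) * (Real.pi / 2 * x)
        - Real.sin (Real.pi / 2 * x) * (Real.pi / 2)) / (Real.pi / 2 * x) ^ 2) x := by
    refine (hlin.sin.fun_div hlin (by positivity)).congr_of_eventuallyEq ?_
    filter_upwards [lt_mem_nhds h0] with z hz
    exact Real.sinc_of_ne_zero (by positivity)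
  have hne : Real.sinc (Real.pi / 2 * x) ≠ 0 := by
    rw [Real.sinc_of_ne_zero (by positivity)]; positivity
  refine ((hsinc.log hne).fun_sub (hlin.cos.log hc.ne')).congr_deriv ?_
  rw [Real.sinc_of_ne_zero (by positivity),
    show Real.pi * x = 2 * (Real.pi / 2 * x) by ring, Real.sin_two_mul]
  have hsc := Real.sin_sq_add_cos_sq (Real.pi / 2 * x)
  generalize Real.sin (Real.pi / 2 * x) = S at *
  generalize Real.cos (Real.pi / 2 * x) = K at *
  field_simp
  linear_combination (Real.pi * x) * hsc

lemma periodicGap_nonneg {x : ℝ} (h0 : 0 < x) (h1 : x < 1) :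
    0 ≤ (Real.sin (Real.pi * x) / Real.pi)⁻¹ - x⁻¹ := by
  have hπ := Real.pi_pos
  have hs : 0 < Real.sin (Real.pi * x) :=
    Real.sin_pos_of_pos_of_lt_pi (by positivity) (by nlinarith)
  have : Real.sin (Real.pi * x) / Real.pi ≤ x := by
    rw [div_le_iff₀ hπ, mul_comm x]
    exact Real.sin_le (by positivity)
  exact sub_nonneg.2 (inv_anti₀ (by positivity) this)

lemma continuousOn_log_sinc_sub_log_cos :
    ContinuousOn (fun z => Real.log (Real.sinc (Real.pi / 2 * z))
      - Real.log (Real.cos (Real.pi / 2 * z))) (Set.Icc 0 (1 / 2)) := by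
  have hπ := Real.pi_pos
  refine ContinuousOn.sub (ContinuousOn.log ?_ ?_) (ContinuousOn.log (by fun_prop) ?_)
  · exact (Real.continuous_sinc.comp (by fun_prop)).continuousOn
  · rintro z ⟨h0, h1⟩
    rcases h0.eq_or_lt with rfl | h0
    · simp
    · rw [Real.sinc_of_ne_zero (by positivity)]
      have : 0 < Real.sin (Real.pi / 2 * z) :=
        Real.sin_pos_of_pos_of_lt_pi (by positivity) (by nlinarith)
      positivity
  · rintro z ⟨h0, h1⟩
    exact (Real.cos_pos_of_mem_Ioo ⟨by nlinarith, by nlinarith⟩).ne'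

/-- The gap between the periodic and the straight line singularities. -/
def periodicGap (σ : ℝ) : ℝ := |Real.sin (Real.pi * σ) / Real.pi|⁻¹ - |σ|⁻¹

lemma periodicGap_neg (σ : ℝ) : periodicGap (-σ) = periodicGap σ := by
  unfold periodicGap
  rw [mul_neg, Real.sin_neg, neg_div, abs_neg, abs_neg]

lemma periodicGap_of_pos {x : ℝ} (h0 : 0 < x) (h1 : x < 1) :
    periodicGap x = (Real.sin (Real.pi * x) / Real.pi)⁻¹ - x⁻¹ := by
  have hπ := Real.pi_pos
  have hs : 0 < Real.sin (Real.pi * x) :=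
    Real.sin_pos_of_pos_of_lt_pi (by positivity) (by nlinarith)
  rw [periodicGap, abs_of_pos h0, abs_of_pos (by positivity)]

lemma intervalIntegrable_periodicGap_half : IntervalIntegrable periodicGap volume 0 (1 / 2) := by
  rw [intervalIntegrable_iff_integrableOn_Ioc_of_le (by norm_num)]
  refine intervalIntegral.integrableOn_deriv_of_nonneg continuousOn_log_sinc_sub_log_cos
    (fun x hx => ?_) (fun x hx => ?_) <;>
  rw [periodicGap_of_pos hx.1 (by linarith [hx.2])]
  · exact hasDerivAt_log_sinc_sub_log_cos hx.1 (by linarith [hx.2])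
  · exact periodicGap_nonneg hx.1 (by linarith [hx.2])

lemma integral_periodicGap_half :
    ∫ σ in (0 : ℝ)..(1 / 2), periodicGap σ = -Real.log (Real.pi / 4) := by
  have hπ := Real.pi_pos
  rw [intervalIntegral.integral_eq_sub_of_hasDerivAt_of_le (by norm_num)
    continuousOn_log_sinc_sub_log_cos (fun x hx => ?_) intervalIntegrable_periodicGap_half]
  · rw [mul_zero, Real.sinc_zero, Real.cos_zero, Real.sinc_of_ne_zero (by positivity),
      show Real.pi / 2 * (1 / 2) = Real.pi / 4 by ring, Real.sin_pi_div_four, Real.cos_pi_div_four,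
      Real.log_div (by positivity) (by positivity)]
    simp
  · rw [periodicGap_of_pos hx.1 (by linarith [hx.2])]
    exact hasDerivAt_log_sinc_sub_log_cos hx.1 (by linarith [hx.2])

lemma intervalIntegrable_periodicGap :
    IntervalIntegrable periodicGap volume (-(1 / 2)) (1 / 2) := by
  refine IntervalIntegrable.trans (b := 0) ?_ intervalIntegrable_periodicGap_half
  have := (IntervalIntegrable.iff_comp_neg (f := periodicGap) (a := 0) (b := 1 / 2)).1
    intervalIntegrable_periodicGap_half
  simpa only [periodicGap_neg, neg_zero] using this.symm

lemma integral_periodicGap :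
    ∫ σ in (-(1 / 2) : ℝ)..(1 / 2), periodicGap σ = -2 * Real.log (Real.pi / 4) := by
  have h := intervalIntegral.integral_comp_neg periodicGap (a := 0) (b := 1 / 2)
  simp only [periodicGap_neg, neg_zero] at h
  rw [← intervalIntegral.integral_add_adjacent_intervals (b := 0)
    (intervalIntegrable_periodicGap.mono_set (by
      rw [Set.uIcc_of_le (by norm_num), Set.uIcc_of_le (by norm_num)]
      exact Set.Icc_subset_Icc_right (by norm_num)))
    intervalIntegrable_periodicGap_half, ← h, integral_periodicGap_half]
  ring

lemma integral_lorentz_le {δ : ℝ} (hδ : 0 < δ) :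
    ∫ σ in (-(1 / 2) : ℝ)..(1 / 2), δ ^ 2 / (σ ^ 2 + δ ^ 2) ≤ 4 * δ := by
  rw [intervalIntegral.integral_eq_sub_of_hasDerivAt (f := fun z => δ * Real.arctan (z / δ))]
  · have h1 := Real.arctan_lt_pi_div_two (1 / 2 / δ)
    have h2 := Real.neg_pi_div_two_lt_arctan (-(1 / 2) / δ)
    have := Real.pi_le_four
    nlinarith
  · intro p _
    refine (((hasDerivAt_id' p).div_const δ).arctan.const_mul δ).congr_deriv ?_
    have : 0 < p ^ 2 + δ ^ 2 := by positivity
    field_simp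
    ring
  · refine Continuous.intervalIntegrable ?_ _ _
    have : ∀ σ : ℝ, σ ^ 2 + δ ^ 2 ≠ 0 := fun σ => by positivity
    fun_prop (disch := exact this)

lemma regRadius_half_bounds {δ : ℝ} (hδ : 0 < δ) :
    1 / 2 ≤ regRadius δ (1 / 2) ∧ regRadius δ (1 / 2) ≤ 1 / 2 + δ := by
  constructor
  · exact Real.le_sqrt_of_sq_le (by nlinarith)
  · exact Real.sqrt_le_iff.2 ⟨by positivity, by nlinarith⟩

lemma abs_arsinh_add_log_le {δ : ℝ} (hδ : 0 < δ) :
    |Real.arsinh (1 / 2 / δ) + Real.log δ| ≤ δ := by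
  obtain ⟨h1, h2⟩ := regRadius_half_bounds hδ
  have h : Real.arsinh (1 / 2 / δ) + Real.log δ = Real.log (1 / 2 + regRadius δ (1 / 2)) := by
    have : √(1 + (1 / 2 / δ) ^ 2) * δ = regRadius δ (1 / 2) := by
      rw [regRadius, show (1 / 2 : ℝ) ^ 2 + δ ^ 2 = (1 + (1 / 2 / δ) ^ 2) * δ ^ 2 by
        field_simp; ring, Real.sqrt_mul (by positivity), Real.sqrt_sq hδ.le]
    rw [Real.arsinh, ← Real.log_mul (by positivity) hδ.ne', add_mul, this]
    congr 2
    field_simp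
  rw [h, abs_of_nonneg (Real.log_nonneg (by linarith))]
  linarith [Real.log_le_sub_one_of_pos (show 0 < 1 / 2 + regRadius δ (1 / 2) by linarith)]

lemma norm_le_C0norm {f : ℝ → V3} (hf : Continuous f) (hper : ∀ s, f (s + 1) = f s) (s : ℝ) :
    ‖f s‖ ≤ C0norm f := by
  obtain ⟨B, hB⟩ := (Function.Periodic.isBounded_of_continuous (c := 1) hper one_ne_zero
    hf).exists_norm_le
  exact le_ciSup (f := fun s => ‖f s‖) ⟨B, by rintro _ ⟨t, rfl⟩; exact hB _ ⟨t, rfl⟩⟩ s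

lemma norm_sub_le_of_deriv {f : ℝ → V3} {B : ℝ} (hf : Differentiable ℝ f)
    (hB : ∀ s, ‖deriv f s‖ ≤ B) (s t : ℝ) : ‖f s - f t‖ ≤ B * |s - t| :=
  convex_univ.norm_image_sub_le_of_norm_deriv_le (𝕜 := ℝ) (fun z _ => hf z) (fun z _ => hB z)
    (Set.mem_univ _) (Set.mem_univ _)

lemma SlenderGeom.norm_sub_tangent_le {cΓ κmax : ℝ} {X en1 en2 : ℝ → V3}
    (h : SlenderGeom cΓ κmax X en1 en2) (s σ : ℝ) :
    ‖X s - X (s - σ) - σ • deriv X s‖ ≤ κmax * σ ^ 2 := by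
  have hκ : 0 ≤ κmax := (norm_nonneg _).trans (h.curvature_max 0)
  have hX : Differentiable ℝ X := h.smooth.differentiable (by norm_num)
  have hX' : Differentiable ℝ (deriv X) :=
    (h.smooth.deriv' (n := 1)).differentiable (by norm_num)
  have hd : ∀ z, HasDerivAt (fun z => X z - z • deriv X s) (deriv X z - deriv X s) z := fun z => by
    simpa using (hX z).hasDerivAt.fun_sub ((hasDerivAt_id' z).smul_const (deriv X s))
  have key := (convex_Icc (s - |σ|) (s + |σ|)).norm_image_sub_le_of_norm_deriv_le (𝕜 := ℝ)
    (f := fun z => X z - z • deriv X s) (C := κmax * |σ|) (x := s - σ) (y := s)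
    (fun z _ => (hd z).differentiableAt) (fun z hz => ?_)
    ⟨by linarith [le_abs_self σ], by linarith [neg_abs_le σ]⟩
    ⟨by linarith [abs_nonneg σ], by linarith [abs_nonneg σ]⟩
  · rw [sub_sub_cancel, Real.norm_eq_abs, mul_assoc, ← sq, sq_abs] at key
    rwa [show X s - X (s - σ) - σ • deriv X s
      = X s - s • deriv X s - (X (s - σ) - (s - σ) • deriv X s) by module]
  · rw [(hd z).deriv]
    refine (norm_sub_le_of_deriv hX' h.curvature_max z s).trans ?_
    have : |z - s| ≤ |σ| := abs_le.2 ⟨by linarith [hz.1], by linarith [hz.2]⟩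
    gcongr

lemma integral_eq_integral_sub_left {F : ℝ → V3} (hF : ∀ t, F (t + 1) = F t) (s : ℝ) :
    ∫ t in (0 : ℝ)..1, F t = ∫ σ in (-(1 / 2) : ℝ)..(1 / 2), F (s - σ) := by
  have h := Function.Periodic.intervalIntegral_add_eq (f := F) (T := 1) hF 0 (s - 1 / 2)
  rw [intervalIntegral.integral_comp_sub_left F s, sub_neg_eq_add]
  rw [zero_add] at h
  rw [h]
  congr 1
  ring

lemma measurable_kernelDefect {δ : ℝ} (hδ : 0 < δ) {y v : ℝ → V3} (hy : Measurable y)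
    (hv : Measurable v) : Measurable fun σ => kernelDefect δ (y σ) (v σ) := by
  have h1 : Measurable (defectId δ) := (continuous_regCoeffId hδ).measurable.sub measurable_inv
  have h2 : Measurable (defectDyad δ) :=
    (continuous_regCoeffDyad hδ).measurable.sub (measurable_id.pow_const 3).inv
  exact ((h1.comp hy.norm).smul hv).add (((h2.comp hy.norm).mul (hy.inner hv)).smul hy)

lemma regKernel_eq_kernelDefect_add {δ : ℝ} (y v : V3) :
    stokesletReg δ y v + (δ ^ 2 / 2) • doubletReg δ y v
      = kernelDefect δ y v + (‖y‖⁻¹ • v + (‖y‖ ^ 3)⁻¹ • ⟪y, v⟫ • y) := by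
  rw [regKernel_eq]
  unfold kernelDefect defectId defectDyad
  module

lemma kernelDefect_tangent (δ : ℝ) {σ : ℝ} (hσ : σ ≠ 0) {e v : V3} (he : ‖e‖ = 1) :
    kernelDefect δ (σ • e) v = regCoeffId δ σ • v + (regCoeffDyad δ σ * σ ^ 2) • ⟪e, v⟫ • e
      - |σ|⁻¹ • (v + ⟪e, v⟫ • e) := by
  have hy : ‖σ • e‖ = |σ| := by rw [norm_smul, he, mul_one, Real.norm_eq_abs]
  have h1 : regCoeffId δ |σ| = regCoeffId δ σ := by simp only [regCoeffId, regRadius_abs]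
  have h2 : regCoeffDyad δ |σ| = regCoeffDyad δ σ := by simp only [regCoeffDyad, regRadius_abs]
  have h3 : (|σ| ^ 3)⁻¹ * σ ^ 2 = |σ|⁻¹ := by
    rw [← sq_abs σ]
    have := abs_pos.2 hσ
    field_simp
  unfold kernelDefect defectId defectDyad
  rw [hy, h1, h2, real_inner_smul_left, smul_smul, ← h3]
  module

/-- The regularized kernel applied to a constant density along the tangent line, together with the
gap between the periodic and the straight line singularities. -/
def tangentKernel (δ : ℝ) (e v : V3) (σ : ℝ) : V3 :=
  regCoeffId δ σ • v + (regCoeffDyad δ σ * σ ^ 2) • ⟪e, v⟫ • e + periodicGap σ • (v + ⟪e, v⟫ • e)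

lemma intervalIntegrable_periodicGap_smul (v : V3) :
    IntervalIntegrable (fun σ => periodicGap σ • v) volume (-(1 / 2)) (1 / 2) :=
  ⟨intervalIntegrable_periodicGap.1.smul_const v, intervalIntegrable_periodicGap.2.smul_const v⟩

lemma intervalIntegrable_tangentKernel {δ : ℝ} (hδ : 0 < δ) (e v : V3) :
    IntervalIntegrable (tangentKernel δ e v) volume (-(1 / 2)) (1 / 2) := by
  have h1 := continuous_regCoeffId hδ
  have h2 := continuous_regCoeffDyad hδ
  refine IntervalIntegrable.add (Continuous.intervalIntegrable (by fun_prop) _ _) ?_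
  exact intervalIntegrable_periodicGap_smul _

lemma integral_tangentKernel {δ : ℝ} (hδ : 0 < δ) (e v : V3) :
    ∫ σ in (-(1 / 2) : ℝ)..(1 / 2), tangentKernel δ e v σ
      = (2 * Real.arsinh (1 / 2 / δ) - 2 * Real.log (Real.pi / 4)) • (v + ⟪e, v⟫ • e)
        + (1 / 2 / regRadius δ (1 / 2)) ^ 3 • v
        - (2 * (1 / 2 / regRadius δ (1 / 2)) + (1 / 2 / regRadius δ (1 / 2)) ^ 3) • ⟪e, v⟫ • e := by
  have h1 := continuous_regCoeffId hδ
  have h2 := continuous_regCoeffDyad hδ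
  unfold tangentKernel
  rw [intervalIntegral.integral_add (Continuous.intervalIntegrable (by fun_prop) _ _)
    (intervalIntegrable_periodicGap_smul _),
    intervalIntegral.integral_add (Continuous.intervalIntegrable (by fun_prop) _ _)
      (Continuous.intervalIntegrable (by fun_prop) _ _)]
  simp only [intervalIntegral.integral_smul_const]
  rw [integral_regCoeffId hδ, integral_regCoeffDyad hδ, integral_periodicGap]
  module

lemma norm_tangent_remainder_le {δ : ℝ} (hδ : 0 < δ) {M : ℝ} {e v : V3} (he : ‖e‖ = 1)
    (hv : ‖v‖ ≤ M) :
    ‖(2 * (Real.arsinh (1 / 2 / δ) + Real.log δ)) • (v + ⟪e, v⟫ • e)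
        + ((1 / 2 / regRadius δ (1 / 2)) ^ 3 - 1) • v
        + (3 - 2 * (1 / 2 / regRadius δ (1 / 2)) - (1 / 2 / regRadius δ (1 / 2)) ^ 3) • ⟪e, v⟫ • e‖
      ≤ 20 * δ * M := by
  have hM : 0 ≤ M := (norm_nonneg v).trans hv
  obtain ⟨hρ1, hρ2⟩ := regRadius_half_bounds hδ
  have hlog := abs_arsinh_add_log_le hδ
  have hρ0 : 0 < regRadius δ (1 / 2) := by linarith
  have hu0 : 0 ≤ 1 / 2 / regRadius δ (1 / 2) := by positivity
  have hu1 : 1 / 2 / regRadius δ (1 / 2) ≤ 1 := (div_le_one hρ0).2 hρ1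
  have hu2 : 1 - 2 * δ ≤ 1 / 2 / regRadius δ (1 / 2) := by
    rw [le_div_iff₀ hρ0]
    nlinarith
  set u := 1 / 2 / regRadius δ (1 / 2)
  have hcube : u ^ 3 ≤ 1 := pow_le_one₀ hu0 hu1
  have hcube' : 1 - 6 * δ ≤ u ^ 3 := by
    nlinarith [mul_nonneg hu0 (sub_nonneg.2 hu1), mul_nonneg (sq_nonneg u) (sub_nonneg.2 hu1)]
  have hev : ‖⟪e, v⟫ • e‖ ≤ M := by
    rw [norm_smul, he, mul_one]
    exact (norm_inner_le_norm e v).trans (by rwa [he, one_mul])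
  have hG : ‖v + ⟪e, v⟫ • e‖ ≤ 2 * M := (norm_add_le _ _).trans (by linarith)
  refine norm_add₃_le.trans ?_
  rw [norm_smul, norm_smul (u ^ 3 - 1), norm_smul (3 - 2 * u - u ^ 3)]
  simp only [Real.norm_eq_abs]
  have a1 : |2 * (Real.arsinh (1 / 2 / δ) + Real.log δ)| ≤ 2 * δ := by
    rw [abs_mul, abs_two]
    gcongr
  have a2 : |u ^ 3 - 1| ≤ 6 * δ := abs_le.2 ⟨by linarith, by linarith⟩
  have a3 : |3 - 2 * u - u ^ 3| ≤ 10 * δ := abs_le.2 ⟨by linarith, by linarith⟩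
  calc _ ≤ 2 * δ * (2 * M) + 6 * δ * M + 10 * δ * M := by gcongr
    _ = _ := by ring

lemma SlenderGeom.norm_curve_defect_le {cΓ κmax : ℝ} (hcΓ : 0 < cΓ) {X en1 en2 f : ℝ → V3}
    (h : SlenderGeom cΓ κmax X en1 en2) {δ : ℝ} (hδ : 0 < δ) (hf : ContDiff ℝ 1 f)
    (hper : ∀ s, f (s + 1) = f s) (s : ℝ) {σ : ℝ} (hσ : σ ≠ 0) (hσ' : |σ| ≤ 1 / 2) :
    ‖kernelDefect δ (X s - X (s - σ)) (f (s - σ)) - kernelDefect δ (σ • deriv X s) (f s)‖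
      ≤ defectConst (min cΓ 1) κmax * C1norm f * (δ ^ 2 / (σ ^ 2 + δ ^ 2)) := by
  have hf' : ∀ t, deriv f (t + 1) = deriv f t := fun t => by
    rw [← deriv_comp_add_const f 1 t]
    simp only [hper]
  have b1 := norm_le_C0norm hf.continuous hper
  have b2 := norm_le_C0norm (hf.continuous_deriv le_rfl) hf'
  have p1 := (norm_nonneg _).trans (b1 0)
  have p2 := (norm_nonneg _).trans (b2 0)
  refine norm_kernelDefect_sub_le (lt_min hcΓ one_pos) (min_le_right _ _)
    ((norm_nonneg _).trans (h.curvature_max 0)) hδ hσ (h.arclength s)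
    (h.norm_sub_tangent_le s σ) ?_ ?_ ?_ ?_
  · have := h.no_self_intersect s (s - σ) (by rwa [sub_sub_cancel])
    rw [sub_sub_cancel] at this
    exact le_trans (by gcongr; exact min_le_left _ _) this
  · have := norm_sub_le_of_deriv (h.smooth.differentiable (by norm_num))
      (fun z => (h.arclength z).le) s (s - σ)
    rwa [sub_sub_cancel, one_mul] at this
  · exact (b1 s).trans (le_add_of_nonneg_right p2)
  · have := norm_sub_le_of_deriv (hf.differentiable (by norm_num)) b2 (s - σ) s
    rw [sub_sub_cancel_left, abs_neg] at this
    refine this.trans ?_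
    gcongr
    exact le_add_of_nonneg_left p1

lemma SlenderGeom.integral_sub_integral {cΓ κmax : ℝ} (hcΓ : 0 < cΓ) {X en1 en2 f : ℝ → V3}
    (h : SlenderGeom cΓ κmax X en1 en2) {δ : ℝ} (hδ : 0 < δ) (hf : ContDiff ℝ 1 f)
    (hper : ∀ s, f (s + 1) = f s) (s : ℝ) :
    ∃ d : V3, ‖d‖ ≤ defectConst (min cΓ 1) κmax * C1norm f * (4 * δ) ∧
      (∫ t in (0 : ℝ)..1, (stokesletReg δ (X s - X t) (f t)
          + (δ ^ 2 / 2) • doubletReg δ (X s - X t) (f t)))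
        - (∫ t in (0 : ℝ)..1,
          ((‖X s - X t‖⁻¹ • f t
              + (‖X s - X t‖ ^ 3)⁻¹ • ⟪X s - X t, f t⟫ • (X s - X t))
            - |Real.sin (Real.pi * (s - t)) / Real.pi|⁻¹
                • (f s + ⟪deriv X s, f s⟫ • deriv X s)))
      = d + ∫ σ in (-(1 / 2) : ℝ)..(1 / 2), tangentKernel δ (deriv X s) (f s) σ := by
  have hXc : Continuous X := h.smooth.continuous
  have hfc : Continuous f := hf.continuous
  set D : ℝ → V3 := fun σ =>
    kernelDefect δ (X s - X (s - σ)) (f (s - σ)) - kernelDefect δ (σ • deriv X s) (f s) with hD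
  have hne : ∀ᵐ σ : ℝ, σ ≠ 0 := compl_mem_ae_iff.2 (measure_singleton 0)
  have hDbound : ∀ᵐ σ : ℝ, σ ∈ Set.Ioc (-(1 / 2) : ℝ) (1 / 2) → ‖D σ‖
      ≤ defectConst (min cΓ 1) κmax * C1norm f * (δ ^ 2 / (σ ^ 2 + δ ^ 2)) := by
    filter_upwards [hne] with σ hσ hmem
    exact h.norm_curve_defect_le hcΓ hδ hf hper s hσ (abs_le.2 ⟨hmem.1.le, hmem.2⟩)
  have hWint : IntervalIntegrable (fun σ : ℝ =>
      defectConst (min cΓ 1) κmax * C1norm f * (δ ^ 2 / (σ ^ 2 + δ ^ 2)))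
      volume (-(1 / 2)) (1 / 2) := by
    refine Continuous.intervalIntegrable ?_ _ _
    have : ∀ σ : ℝ, σ ^ 2 + δ ^ 2 ≠ 0 := fun σ => by positivity
    fun_prop (disch := exact this)
  have hDmeas : Measurable D :=
    (measurable_kernelDefect hδ (by fun_prop) (by fun_prop)).sub
      (measurable_kernelDefect hδ (by fun_prop) measurable_const)
  have hDint : IntervalIntegrable D volume (-(1 / 2)) (1 / 2) := by
    refine hWint.mono_fun' hDmeas.aestronglyMeasurable ?_
    rw [Set.uIoc_of_le (by norm_num)]
    exact (ae_restrict_iff' measurableSet_Ioc).2 hDbound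
  have hTint := intervalIntegrable_tangentKernel hδ (deriv X s) (f s)
  have hAint : IntervalIntegrable (fun σ => stokesletReg δ (X s - X (s - σ)) (f (s - σ))
      + (δ ^ 2 / 2) • doubletReg δ (X s - X (s - σ)) (f (s - σ))) volume (-(1 / 2)) (1 / 2) := by
    simp only [regKernel_eq]
    have h1 := continuous_regCoeffId hδ
    have h2 := continuous_regCoeffDyad hδ
    exact Continuous.intervalIntegrable (by fun_prop) _ _
  refine ⟨∫ σ in (-(1 / 2) : ℝ)..(1 / 2), D σ, ?_, ?_⟩
  · refine (intervalIntegral.norm_integral_le_of_norm_le (by norm_num) hDbound hWint).trans ?_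
    rw [intervalIntegral.integral_const_mul]
    refine mul_le_mul_of_nonneg_left (integral_lorentz_le hδ) ?_
    have hpos := (norm_nonneg _).trans (h.norm_curve_defect_le hcΓ hδ hf hper s
      (σ := 1 / 2) (by norm_num) (by norm_num [abs_of_pos]))
    exact nonneg_of_mul_nonneg_left hpos (by positivity)
  · rw [integral_eq_integral_sub_left (s := s) fun t => by simp only [h.periodicX, hper],
      integral_eq_integral_sub_left (s := s) fun t => by
        rw [h.periodicX, hper, show Real.pi * (s - (t + 1)) = Real.pi * (s - t) - Real.pi by ring,
          Real.sin_sub_pi, neg_div, abs_neg],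
      ← intervalIntegral.integral_add hDint hTint, sub_eq_iff_eq_add, ← sub_eq_iff_eq_add',
      ← intervalIntegral.integral_sub hAint (hDint.add hTint)]
    refine intervalIntegral.integral_congr_ae ?_
    filter_upwards [hne] with σ hσ _
    rw [regKernel_eq_kernelDefect_add, sub_sub_cancel]
    simp only [hD, kernelDefect_tangent δ hσ (h.arclength s), tangentKernel, periodicGap]
    module

lemma defectConst_nonneg {c κ : ℝ} (hc : 0 < c) (hκ : 0 ≤ κ) : 0 ≤ defectConst c κ := by
  unfold defectConst
  positivity

/-- Along the fiber centerline, the regularized and classical (Keller–Rubinow)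
slender-body fiber velocities differ by the explicit logarithmic term
`2 log(δ/ε)(I + e_s e_sᵀ) f(s)`, with error `C(ε|log ε| + δ|log δ|)‖f‖_{C¹}`. -/
theorem centerline_log_discrepancy (cΓ κmax : ℝ) (hcΓ : 0 < cΓ) :
    ∃ C > 0, ∃ ε₀ > 0,
      ∀ X en1 en2 : ℝ → V3, SlenderGeom cΓ κmax X en1 en2 →
      ∀ ε δ : ℝ, 0 < ε → ε < ε₀ → 0 < δ → δ < ε₀ →
      ∀ f : ℝ → V3, ContDiff ℝ 1 f → (∀ s, f (s + 1) = f s) →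
      ∀ s : ℝ,
        ‖(8 * Real.pi) • (uReg X f (δ ^ 2 / 2) δ (X s) - uSBC X f ε s)
            + (2 * Real.log (δ / ε)) • (f s + ⟪deriv X s, f s⟫ • deriv X s)‖
          ≤ C * (ε * |Real.log ε| + δ * |Real.log δ|) * C1norm f := by
  have hc : 0 < min cΓ 1 := lt_min hcΓ one_pos
  have hK := defectConst_nonneg hc (abs_nonneg κmax)
  refine ⟨4 * defectConst (min cΓ 1) |κmax| + 20, by positivity, Real.exp (-1), Real.exp_pos _, ?_⟩
  intro X en1 en2 h ε δ hε _ hδ hδ' f hf hper s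
  rw [abs_of_nonneg ((norm_nonneg _).trans (h.curvature_max 0))] at hK ⊢
  obtain ⟨d, hd, hint⟩ := h.integral_sub_integral hcΓ hδ hf hper s
  have hM0 : 0 ≤ C0norm (deriv f) := Real.iSup_nonneg fun _ => norm_nonneg _
  have hM : ‖f s‖ ≤ C1norm f :=
    (norm_le_C0norm hf.continuous hper s).trans (le_add_of_nonneg_right hM0)
  have hM' : 0 ≤ C1norm f := (norm_nonneg _).trans hM
  rw [integral_tangentKernel hδ] at hint
  have hrem := norm_tangent_remainder_le hδ (h.arclength s) hM
  have hlog : δ ≤ δ * |Real.log δ| := by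
    have : Real.log δ < -1 := (Real.log_lt_iff_lt_exp hδ).2 hδ'
    rw [abs_of_neg (by linarith)]
    nlinarith
  have hπ := Real.pi_pos
  have hlogs : 2 * Real.log (Real.pi * ε / 4) + 2 * Real.log (δ / ε)
      = 2 * Real.log (Real.pi / 4) + 2 * Real.log δ := by
    rw [show Real.pi * ε / 4 = Real.pi / 4 * ε by ring, Real.log_mul (by positivity) hε.ne',
      Real.log_div hδ.ne' hε.ne']
    ring
  unfold uReg uSBC
  rw [← smul_sub, smul_inv_smul₀ (by positivity)]
  set IA := ∫ t in (0 : ℝ)..1, (stokesletReg δ (X s - X t) (f t)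
    + (δ ^ 2 / 2) • doubletReg δ (X s - X t) (f t))
  rw [sub_eq_iff_eq_add] at hint
  rw [hint]
  refine (norm_add_le_of_le hd hrem |>.trans' (le_of_eq ?_)).trans ?_
  · congr 1
    rw [show 2 * Real.log (δ / ε) = 2 * Real.log (Real.pi / 4) + 2 * Real.log δ
      - 2 * Real.log (Real.pi * ε / 4) by linarith]
    module
  · calc _ = (4 * defectConst (min cΓ 1) κmax + 20) * δ * C1norm f := by ring
      _ ≤ _ := by
        gcongr
        have : 0 ≤ ε * |Real.log ε| := by positivity
        linarith
end
end

section
/- Logarithmic case of the basic kernel integral bound: let m ≥ 0 be an integer. There exist constants C > 0 and ε₀ > 0, depending only on m, c_Γ, and κ_max, such that for all 0 < ε < ε₀, 0 < δ < ε₀, every s ∈ ℝ/ℤ and θ ∈ [0,2π), ∫_{−1/2}^{1/2} |s̄|^m / (|R(s,s̄,θ)|² + δ²)^{(m+1)/2} ds̄ ≤ C |log(ε² + δ²)|. -/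
open MeasureTheory

noncomputable section

local notation "⟪" x ", " y "⟫" => @inner ℝ _ _ x y

theorem SlenderGeom.norm_ePerp {cΓ κmax : ℝ} {X en1 en2 : ℝ → V3}
    (h : SlenderGeom cΓ κmax X en1 en2) (s θ : ℝ) : ‖ePerp en1 en2 s θ‖ = 1 := by
  have hsq : ‖ePerp en1 en2 s θ‖ ^ 2 = 1 := by
    rw [ePerp, norm_add_sq_real, norm_smul, norm_smul, real_inner_smul_left,
      real_inner_smul_right, h.en1_en2 s, h.en1_unit s, h.en2_unit s, Real.norm_eq_abs,
      Real.norm_eq_abs, mul_one, mul_one, sq_abs, sq_abs]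
    linarith [Real.sin_sq_add_cos_sq θ]
  nlinarith [norm_nonneg (ePerp en1 en2 s θ)]

theorem SlenderGeom.inner_deriv_ePerp {cΓ κmax : ℝ} {X en1 en2 : ℝ → V3}
    (h : SlenderGeom cΓ κmax X en1 en2) (s θ : ℝ) : ⟪deriv X s, ePerp en1 en2 s θ⟫ = 0 := by
  rw [ePerp, inner_add_right, real_inner_smul_right, real_inner_smul_right, h.es_en1 s,
    h.es_en2 s]
  ring

theorem SlenderGeom.norm_deriv_sub_le {cΓ κmax : ℝ} {X en1 en2 : ℝ → V3}
    (h : SlenderGeom cΓ κmax X en1 en2) (s t : ℝ) :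
    ‖deriv X t - deriv X s‖ ≤ κmax * |t - s| := by
  have hd : Differentiable ℝ (deriv X) :=
    ((contDiff_succ_iff_deriv (n := 1)).1 (by simpa [one_add_one_eq_two] using h.smooth)).2.2
      |>.differentiable one_ne_zero
  exact convex_univ.norm_image_sub_le_of_norm_deriv_le (fun x _ => hd x)
    (fun x _ => h.curvature_max x) (Set.mem_univ s) (Set.mem_univ t)

/-- A chord leaves the tangent line only to second order in the arclength. -/
theorem SlenderGeom.abs_inner_chord_ePerp_le {cΓ κmax : ℝ} {X en1 en2 : ℝ → V3}
    (h : SlenderGeom cΓ κmax X en1 en2) (s θ u : ℝ) :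
    |⟪X s - X (s - u), ePerp en1 en2 s θ⟫| ≤ κmax * u ^ 2 := by
  have hκ : 0 ≤ κmax := (norm_nonneg _).trans (h.curvature_max 0)
  have hX : Differentiable ℝ X := h.smooth.differentiable two_ne_zero
  set e := ePerp en1 en2 s θ with he
  have hder : ∀ t, HasDerivAt (fun t => ⟪X t, e⟫) ⟪deriv X t, e⟫ t := fun t => by
    simpa using (hX t).hasDerivAt.inner ℝ (hasDerivAt_const t e)
  have hbound : ∀ t ∈ Set.uIcc s (s - u), ‖⟪deriv X t, e⟫‖ ≤ κmax * |u| := fun t ht => by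
    have h1 : ⟪deriv X t, e⟫ = ⟪deriv X t - deriv X s, e⟫ := by
      rw [inner_sub_left, h.inner_deriv_ePerp, sub_zero]
    have h2 : |t - s| ≤ |u| := by
      simpa using Set.abs_sub_left_of_mem_uIcc ht
    calc ‖⟪deriv X t, e⟫‖ ≤ ‖deriv X t - deriv X s‖ * ‖e‖ := h1 ▸ norm_inner_le_norm _ _
      _ ≤ κmax * |t - s| := by
        rw [he, h.norm_ePerp, mul_one]; exact h.norm_deriv_sub_le s t
      _ ≤ κmax * |u| := by gcongr
  have hmvt := (convex_uIcc s (s - u)).norm_image_sub_le_of_norm_hasDerivWithin_le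
    (fun t _ => (hder t).hasDerivWithinAt) hbound Set.right_mem_uIcc Set.left_mem_uIcc
  rw [inner_sub_left]
  calc |⟪X s, e⟫ - ⟪X (s - u), e⟫| ≤ κmax * |u| * ‖s - (s - u)‖ := hmvt
    _ = κmax * u ^ 2 := by
      rw [sub_sub_cancel, Real.norm_eq_abs, mul_assoc, ← sq, sq_abs]

theorem SlenderGeom.le_norm_Rvec_sq {cΓ κmax : ℝ} {X en1 en2 : ℝ → V3} (hcΓ : 0 < cΓ)
    (h : SlenderGeom cΓ κmax X en1 en2) {ε u : ℝ} (hε : 0 ≤ ε) (hεκ : 4 * ε * κmax ≤ cΓ ^ 2)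
    (hu : |u| ≤ 1 / 2) (s θ : ℝ) :
    cΓ ^ 2 / 2 * u ^ 2 + ε ^ 2 ≤ ‖Rvec X en1 en2 ε s u θ‖ ^ 2 := by
  have hchord : cΓ * |u| ≤ ‖X s - X (s - u)‖ := by
    simpa using h.no_self_intersect s (s - u) (by simpa using hu)
  have hsq : cΓ ^ 2 * u ^ 2 ≤ ‖X s - X (s - u)‖ ^ 2 := by
    rw [← sq_abs u, ← mul_pow]
    gcongr
  have hin := (abs_le.1 (h.abs_inner_chord_ePerp_le s θ u)).1
  have hR : ‖Rvec X en1 en2 ε s u θ‖ ^ 2 = ‖X s - X (s - u)‖ ^ 2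
      + 2 * (ε * ⟪X s - X (s - u), ePerp en1 en2 s θ⟫) + ε ^ 2 := by
    rw [Rvec, add_sub_right_comm, norm_add_sq_real, real_inner_smul_right, norm_smul,
      h.norm_ePerp, mul_one, Real.norm_eq_abs, sq_abs]
  rw [hR]
  nlinarith [mul_le_mul_of_nonneg_left hin hε, mul_le_mul_of_nonneg_right hεκ (sq_nonneg u)]

theorem integral_inv_mul_abs_add {k a b : ℝ} (hk : 0 < k) (ha : 0 < a) (hb : 0 ≤ b) :
    ∫ t in (-b)..b, (k * |t| + a)⁻¹ = 2 / k * (Real.log (k * b + a) - Real.log a) := by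
  have hpos : ∀ t : ℝ, 0 < k * |t| + a := fun t => by positivity
  have hcont : Continuous fun t : ℝ => (k * |t| + a)⁻¹ :=
    (by fun_prop : Continuous fun t : ℝ => k * |t| + a).inv₀ fun t => (hpos t).ne'
  have hright : ∫ t in (0 : ℝ)..b, (k * |t| + a)⁻¹
      = 1 / k * (Real.log (k * b + a) - Real.log a) := by
    have hder : ∀ t ∈ Set.uIcc 0 b,
        HasDerivAt (fun t => 1 / k * Real.log (k * t + a)) (k * |t| + a)⁻¹ t := fun t ht => by
      rw [Set.uIcc_of_le hb] at ht
      have ht' := hpos t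
      rw [abs_of_nonneg ht.1] at ht' ⊢
      have hval : (k * t + a)⁻¹ = 1 / k * (k * 1 / (k * t + a)) := by field_simp
      rw [hval]
      exact ((((hasDerivAt_id' t).const_mul k).add_const a).log ht'.ne').const_mul (1 / k)
    rw [intervalIntegral.integral_eq_sub_of_hasDerivAt hder (hcont.intervalIntegrable _ _)]
    simp only [mul_zero, zero_add]
    ring
  have hleft : ∫ t in (-b)..0, (k * |t| + a)⁻¹ = ∫ t in (0 : ℝ)..b, (k * |t| + a)⁻¹ := by
    simpa using
      (intervalIntegral.integral_comp_neg (a := 0) (b := b) fun t : ℝ => (k * |t| + a)⁻¹).symm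
  rw [← intervalIntegral.integral_add_adjacent_intervals (b := 0)
    (hcont.intervalIntegrable _ _) (hcont.intervalIntegrable _ _), hleft, hright]
  ring

theorem pow_mul_inv_rpow_le {k a u D : ℝ} (m : ℕ) (hk : 0 < k) (ha : 0 < a)
    (hD : k ^ 2 * u ^ 2 + a ^ 2 ≤ D) :
    |u| ^ m * (D ^ (((m : ℝ) + 1) / 2))⁻¹ ≤ 2 * (k ^ m)⁻¹ * (k * |u| + a)⁻¹ := by
  have hDpos : 0 < D := lt_of_lt_of_le (by positivity) hD
  have hr : 0 < √D := Real.sqrt_pos.2 hDpos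
  have hku : k * |u| ≤ √D := Real.le_sqrt_of_sq_le (by
    rw [mul_pow, sq_abs]; nlinarith [sq_nonneg a])
  have har : a ≤ √D := Real.le_sqrt_of_sq_le (by nlinarith [sq_nonneg (k * u)])
  have hpow : D ^ (((m : ℝ) + 1) / 2) = √D ^ m * √D := by
    rw [← pow_succ, Real.sqrt_eq_rpow, ← Real.rpow_natCast, ← Real.rpow_mul hDpos.le]
    congr 1
    push_cast
    ring
  have h1 : |u| ^ m * (√D ^ m)⁻¹ ≤ (k ^ m)⁻¹ := by
    rw [← div_eq_mul_inv, div_le_iff₀ (by positivity), inv_mul_eq_div,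
      le_div_iff₀ (by positivity), ← mul_pow, mul_comm]
    exact pow_le_pow_left₀ (by positivity) hku m
  have h2 : (√D)⁻¹ ≤ 2 * (k * |u| + a)⁻¹ := by
    rw [← div_eq_mul_inv, le_div_iff₀ (by positivity), inv_mul_eq_div, div_le_iff₀ hr]
    linarith
  calc |u| ^ m * (D ^ (((m : ℝ) + 1) / 2))⁻¹ = |u| ^ m * (√D ^ m)⁻¹ * (√D)⁻¹ := by
        rw [hpow, mul_inv, mul_assoc]
    _ ≤ (k ^ m)⁻¹ * (2 * (k * |u| + a)⁻¹) := by gcongr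
    _ = _ := by ring

/-- Logarithmic case of the basic kernel integral bound:
`∫_{−1/2}^{1/2} |s̄|^m/(|R|²+δ²)^{(m+1)/2} ds̄ ≤ C |log(ε²+δ²)|`. -/
theorem kernel_integral_log_bound (m : ℕ) (cΓ κmax : ℝ) (hcΓ : 0 < cΓ) :
    ∃ C > 0, ∃ ε₀ > 0,
      ∀ X en1 en2 : ℝ → V3, SlenderGeom cΓ κmax X en1 en2 →
      ∀ ε δ : ℝ, 0 < ε → ε < ε₀ → 0 < δ → δ < ε₀ →
      ∀ s θ : ℝ,
        (∫ sb in (-(1:ℝ)/2)..(1/2),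
            |sb| ^ m * ((‖Rvec X en1 en2 ε s sb θ‖ ^ 2 + δ ^ 2) ^ (((m : ℝ) + 1) / 2))⁻¹)
          ≤ C * |Real.log (ε ^ 2 + δ ^ 2)| := by
  set k := min 1 (cΓ / 2) with hkdef
  have hk : 0 < k := by positivity
  have hk1 : k ≤ 1 := min_le_left _ _
  have hkc : k ^ 2 ≤ cΓ ^ 2 / 2 := by
    have : k ≤ cΓ / 2 := min_le_right _ _
    nlinarith
  refine ⟨2 * (k ^ m)⁻¹ / k, by positivity, min (1 / 4) (cΓ ^ 2 / (4 * (|κmax| + 1))),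
    by positivity, ?_⟩
  intro X en1 en2 h ε δ hε hε₀ hδ hδ₀ s θ
  have hε4 : ε < 1 / 4 := hε₀.trans_le (min_le_left _ _)
  have hδ4 : δ < 1 / 4 := hδ₀.trans_le (min_le_left _ _)
  have hεκ : 4 * ε * κmax ≤ cΓ ^ 2 := by
    have h1 := hε₀.trans_le (min_le_right _ _)
    rw [lt_div_iff₀ (by positivity)] at h1
    nlinarith [mul_le_mul_of_nonneg_left (le_abs_self κmax) hε.le]
  set a := √(ε ^ 2 + δ ^ 2) with hadef
  have ha : 0 < a := Real.sqrt_pos.2 (by positivity)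
  have ha2 : a ^ 2 = ε ^ 2 + δ ^ 2 := Real.sq_sqrt (by positivity)
  have ha_half : a ≤ 1 / 2 := Real.sqrt_le_iff.2 ⟨by norm_num, by nlinarith⟩
  have hcont : Continuous fun t : ℝ => 2 * (k ^ m)⁻¹ * (k * |t| + a)⁻¹ :=
    continuous_const.mul ((by fun_prop : Continuous fun t : ℝ => k * |t| + a).inv₀
      fun t => by positivity)
  have hpt : ∀ t ∈ Set.Ioc (-(1 : ℝ) / 2) (1 / 2),
      ‖|t| ^ m * ((‖Rvec X en1 en2 ε s t θ‖ ^ 2 + δ ^ 2) ^ (((m : ℝ) + 1) / 2))⁻¹‖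
        ≤ 2 * (k ^ m)⁻¹ * (k * |t| + a)⁻¹ := fun t ht => by
    have htabs : |t| ≤ 1 / 2 := abs_le.2 ⟨by linarith [ht.1], ht.2⟩
    rw [Real.norm_of_nonneg (by positivity)]
    refine pow_mul_inv_rpow_le m hk ha ?_
    have hR := h.le_norm_Rvec_sq hcΓ hε.le hεκ htabs s θ
    nlinarith [mul_le_mul_of_nonneg_right hkc (sq_nonneg t)]
  have hint := intervalIntegral.norm_integral_le_of_norm_le (μ := volume) (by norm_num)
    (Filter.Eventually.of_forall hpt) (hcont.intervalIntegrable _ _)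
  refine (Real.le_norm_self _).trans (hint.trans ?_)
  have hlog : Real.log (ε ^ 2 + δ ^ 2) = 2 * Real.log a := by
    rw [← ha2, Real.log_pow]; norm_cast
  have hloga : Real.log a ≤ 0 := Real.log_nonpos ha.le (by linarith)
  have hlogk : Real.log (k * (1 / 2) + a) ≤ 0 :=
    Real.log_nonpos (by positivity) (by linarith)
  rw [intervalIntegral.integral_const_mul, neg_div,
    integral_inv_mul_abs_add hk ha (by norm_num), hlog, abs_of_nonpos (by linarith)]
  calc 2 * (k ^ m)⁻¹ * (2 / k * (Real.log (k * (1 / 2) + a) - Real.log a))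
      ≤ 2 * (k ^ m)⁻¹ * (2 / k * (0 - Real.log a)) := by gcongr
    _ = _ := by ring
end
end
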